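/- arXiv:1312.3068 — 3 statements merged into one kernel-verified Lean document; each statement's English description precedes it below -/
import Mathlib

section
/- Let G be a connected unicyclic graph with m edges whose unique cycle C = v₁v₂v₃v₄v₁ has length 4 (girth 4). If there is an index i (mod 4) such that either l(vᵢ) ≥ 4, or l(vᵢ) ≥ 1, l(v_{i+1}) ≥ 2 and l(v_{i+2}) ≥ 1, then rc(G) = m − 4. -/
/-- An edge-colored graph is rainbow connected if every two vertices are
joined by a path no two of whose edges have the same color. -/
def IsRainbowConnected {V α : Type*} (G : SimpleGraph V) (c : Sym2 V → α) : Prop :=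
  ∀ u w : V, ∃ p : G.Walk u w, p.IsPath ∧ (p.edges.map c).Nodup

/-- The rainbow connection number: the minimum number of colors in an
edge-coloring making the graph rainbow connected. -/
noncomputable def rc {V : Type*} (G : SimpleGraph V) : ℕ :=
  sInf {k : ℕ | ∃ c : Sym2 V → Fin k, IsRainbowConnected G c}


/-- The set of edges of the cycle `v 0 — v 1 — ⋯ — v (s-1) — v 0`. -/
def cycleEdges {V : Type*} {s : ℕ} (v : ZMod s → V) : Set (Sym2 V) :=
  {e | ∃ i : ZMod s, e = s(v i, v (i + 1))}

/-- `numLeaves G v i` is `l(vᵢ)`: the number of leaves of the tree `T(vᵢ)`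
attached at the cycle vertex `vᵢ`, i.e. the number of vertices, other than the
root `vᵢ`, of degree 1 in the component of `G − E(C)` containing `vᵢ`. -/
noncomputable def numLeaves {V : Type*} [Fintype V] (G : SimpleGraph V) {s : ℕ}
    (v : ZMod s → V) (i : ZMod s) : ℕ :=
  {x : V | x ≠ v i ∧ (G.deleteEdges (cycleEdges v)).Reachable (v i) x ∧
    ((G.deleteEdges (cycleEdges v)).neighborSet x).ncard = 1}.ncard

open SimpleGraph

section Bridges

variable {V : Type*} {G : SimpleGraph V}

/-- An edge other than a bridge `e` has both endpoints on the same side of `e`. -/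
lemma exists_not_reachable_deleteEdges_of_isBridge {e f : Sym2 V} (he : G.IsBridge e)
    (hf : f ∈ G.edgeSet) (hne : f ≠ e) :
    ∃ a ∈ e, ∀ x ∈ f, ¬ (G.deleteEdges {e}).Reachable a x := by
  induction e with | h a b
  induction f with | h c d
  have hcd : (G.deleteEdges {s(a, b)}).Reachable c d :=
    Adj.reachable (by simpa [deleteEdges_adj] using ⟨hf, by simpa using hne⟩)
  rw [isBridge_iff] at he
  by_cases hac : (G.deleteEdges {s(a, b)}).Reachable a c
  · refine ⟨b, by simp, fun x hx hbx => he ?_⟩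
    rcases Sym2.mem_iff.1 hx with rfl | rfl
    · exact hac.trans hbx.symm
    · exact (hac.trans hcd).trans hbx.symm
  · refine ⟨a, by simp, fun x hx hax => hac ?_⟩
    rcases Sym2.mem_iff.1 hx with rfl | rfl
    · exact hax
    · exact hax.trans hcd.symm

/-- Distinct bridges receive distinct colors in a rainbow coloring. -/
lemma IsRainbowConnected.injOn_bridges {α : Type*} {c : Sym2 V → α}
    (hc : IsRainbowConnected G c) : Set.InjOn c {e | e ∈ G.edgeSet ∧ G.IsBridge e} := by
  rintro e ⟨he, heb⟩ f ⟨hf, hfb⟩ hef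
  by_contra hne
  obtain ⟨a, ha, haf⟩ := exists_not_reachable_deleteEdges_of_isBridge heb hf (Ne.symm hne)
  obtain ⟨b, hb, hbe⟩ := exists_not_reachable_deleteEdges_of_isBridge hfb he hne
  obtain ⟨p, -, hp⟩ := hc a b
  exact hne (List.inj_on_of_nodup_map hp
    (p.mem_edges_of_not_reachable_deleteEdges (haf b hb))
    (p.mem_edges_of_not_reachable_deleteEdges fun h => hbe a ha h.symm) hef)

lemma SimpleGraph.Connected.isTree_deleteEdges_of_not_isBridge [Fintype V] (hconn : G.Connected)
    (huni : G.edgeSet.ncard = Fintype.card V) {e : Sym2 V} (he : e ∈ G.edgeSet)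
    (hb : ¬ G.IsBridge e) : (G.deleteEdges {e}).IsTree := by
  classical
  induction e with | h a b
  rw [isTree_iff_connected_and_card]
  refine ⟨hconn.connected_delete_edge_of_not_isBridge hb, ?_⟩
  rw [Nat.card_coe_set_eq, edgeSet_deleteEdges, Set.ncard_sdiff_singleton_add_one he,
    Nat.card_eq_fintype_card, huni]

/-- A walk whose edges carry pairwise distinct colors yields a rainbow path. -/
lemma SimpleGraph.Walk.exists_rainbow_path {α : Type*} {c : Sym2 V → α} {u w : V} (p : G.Walk u w)
    (h : Set.InjOn c {e | e ∈ p.edges}) :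
    ∃ q : G.Walk u w, q.IsPath ∧ (q.edges.map c).Nodup := by
  classical
  refine ⟨p.bypass, p.bypass_isPath, ?_⟩
  refine List.Nodup.map_on (fun x hx y hy hxy => ?_) p.bypass_isPath.isTrail.edges_nodup
  exact h (p.edges_bypass_subset_edges hx) (p.edges_bypass_subset_edges hy) hxy

/-- A path starting elsewhere meets the edge at a leaf only by ending in that leaf. -/
lemma SimpleGraph.Walk.IsPath.eq_of_leaf_mem_edges {x y : V} (hxy : ∀ z, G.Adj x z → z = y)
    {r u : V} {p : G.Walk r u} (hp : p.IsPath) (hxr : x ≠ r) (he : s(x, y) ∈ p.edges) :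
    x = u := by
  induction p with
  | nil => simp at he
  | @cons r r' u h p ih =>
    rw [cons_isPath_iff] at hp
    rw [edges_cons, List.mem_cons] at he
    by_cases hx : x = r'
    · subst hx
      obtain rfl := hxy _ h.symm
      cases p with
      | nil => rfl
      | cons h' q =>
        obtain rfl := hxy _ h'
        simp at hp
    · refine ih hp.1 hx (he.resolve_left fun h' => ?_)
      rcases Sym2.eq_iff.1 h' with ⟨h1, -⟩ | ⟨h1, -⟩
      · exact hxr h1
      · exact hx h1

lemma SimpleGraph.Walk.leaf_mem_edges {x y : V} (hxy : ∀ z, G.Adj x z → z = y)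
    {r : V} (p : G.Walk r x) (hxr : x ≠ r) : s(x, y) ∈ p.edges := by
  suffices ∀ q : G.Walk x r, s(x, y) ∈ q.edges by simpa using this p.reverse
  intro q
  cases q with
  | nil => exact absurd rfl hxr
  | cons h q =>
    obtain rfl := hxy _ h
    simp

end Bridges

section FourCycle

variable {V : Type*} {G : SimpleGraph V} {v : ZMod 4 → V}

lemma reachable_of_adj_of_ne {i : ZMod 4} (h : ∀ j ≠ i, G.Adj (v j) (v (j + 1))) :
    G.Reachable (v i) (v (i + 1)) := by
  have h1 := (h (i + 1) (by simpa using show (1 : ZMod 4) ≠ 0 by decide)).reachable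
  have h2 := (h (i + 2) (by simpa using show (2 : ZMod 4) ≠ 0 by decide)).reachable
  have h3 := (h (i + 3) (by simpa using show (3 : ZMod 4) ≠ 0 by decide)).reachable
  rw [show i + 1 + 1 = i + 2 by ring] at h1
  rw [show i + 2 + 1 = i + 3 by ring] at h2
  rw [add_assoc, show (3 : ZMod 4) + 1 = 0 by decide, add_zero] at h3
  exact ((h1.trans h2).trans h3).symm

lemma cycleEdge_injective (hinj : Function.Injective v) :
    Function.Injective fun j : ZMod 4 => s(v j, v (j + 1)) := by
  intro i j h
  simp only [Sym2.eq_iff, hinj.eq_iff] at h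
  revert i j
  decide

lemma ncard_cycleEdges (hinj : Function.Injective v) : (cycleEdges v).ncard = 4 := by
  have : cycleEdges v = Set.range fun j : ZMod 4 => s(v j, v (j + 1)) := by
    ext e
    simp [cycleEdges, eq_comm]
  rw [this, ← Set.image_univ, Set.ncard_image_of_injective _ (cycleEdge_injective hinj),
    Set.ncard_univ, Nat.card_zmod]

lemma not_isBridge_cycleEdge (hinj : Function.Injective v)
    (hadj : ∀ i : ZMod 4, G.Adj (v i) (v (i + 1))) (i : ZMod 4) :
    ¬ G.IsBridge s(v i, v (i + 1)) := by
  rw [isBridge_iff, not_not]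
  refine reachable_of_adj_of_ne fun j hj => ?_
  rw [deleteEdges_adj]
  exact ⟨hadj j, fun h => hj (cycleEdge_injective hinj h)⟩

lemma not_reachable_delete_two [Fintype V] (hconn : G.Connected)
    (huni : G.edgeSet.ncard = Fintype.card V) (hinj : Function.Injective v)
    (hadj : ∀ i : ZMod 4, G.Adj (v i) (v (i + 1))) {i j : ZMod 4} (hij : i ≠ j) :
    ¬ ((G.deleteEdges {s(v j, v (j + 1))}).deleteEdges {s(v i, v (i + 1))}).Reachable
      (v i) (v (i + 1)) := by
  have hT := hconn.isTree_deleteEdges_of_not_isBridge huni (hadj j)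
    (not_isBridge_cycleEdge hinj hadj j)
  refine isBridge_iff.1 (isAcyclic_iff_forall_isBridge.1 hT.isAcyclic ?_)
  rw [mem_edgeSet, deleteEdges_adj]
  exact ⟨hadj i, fun h => hij (cycleEdge_injective hinj h)⟩

lemma not_reachable_add_one [Fintype V] (hconn : G.Connected)
    (huni : G.edgeSet.ncard = Fintype.card V) (hinj : Function.Injective v)
    (hadj : ∀ i : ZMod 4, G.Adj (v i) (v (i + 1))) (i : ZMod 4) :
    ¬ (G.deleteEdges (cycleEdges v)).Reachable (v i) (v (i + 1)) := by
  intro h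
  refine not_reachable_delete_two hconn huni hinj hadj
    (show i ≠ i + 1 by simpa using show (1 : ZMod 4) ≠ 0 by decide) (h.mono ?_)
  rw [deleteEdges_deleteEdges]
  refine deleteEdges_anti ?_
  rintro e (rfl | rfl) <;> exact ⟨_, rfl⟩

lemma not_reachable_add_two [Fintype V] (hconn : G.Connected)
    (huni : G.edgeSet.ncard = Fintype.card V) (hinj : Function.Injective v)
    (hadj : ∀ i : ZMod 4, G.Adj (v i) (v (i + 1))) (i : ZMod 4) :
    ¬ (G.deleteEdges (cycleEdges v)).Reachable (v i) (v (i + 2)) := by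
  intro h
  refine not_reachable_delete_two hconn huni hinj hadj
    (show i ≠ i + 2 by simpa using show (2 : ZMod 4) ≠ 0 by decide)
    (Reachable.trans (h.mono ?_) (Adj.reachable ?_).symm)
  · rw [deleteEdges_deleteEdges]
    refine deleteEdges_anti ?_
    rintro e (rfl | rfl) <;> exact ⟨_, rfl⟩
  · rw [deleteEdges_adj, deleteEdges_adj]
    have h1 := hadj (i + 1)
    rw [show i + 1 + 1 = i + 2 by ring] at h1
    have h2 : s(v (i + 1), v (i + 2)) = s(v (i + 1), v (i + 1 + 1)) := by
      rw [show i + 1 + 1 = i + 2 by ring]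
    refine ⟨⟨h1, fun h => ?_⟩, fun h => ?_⟩
    · rw [Set.mem_singleton_iff, h2] at h
      have := cycleEdge_injective hinj h
      revert this; clear * -; revert i; decide
    · rw [Set.mem_singleton_iff, h2] at h
      have := cycleEdge_injective hinj h
      revert this; clear * -; revert i; decide

/-- The trees attached at distinct vertices of the cycle are disjoint. -/
lemma eq_of_reachable_deleteEdges_cycleEdges [Fintype V] (hconn : G.Connected)
    (huni : G.edgeSet.ncard = Fintype.card V) (hinj : Function.Injective v)
    (hadj : ∀ i : ZMod 4, G.Adj (v i) (v (i + 1))) {i j : ZMod 4}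
    (h : (G.deleteEdges (cycleEdges v)).Reachable (v i) (v j)) : i = j := by
  have hcases : i = j ∨ j = i + 1 ∨ j = i + 2 ∨ i = j + 1 := by
    clear h; revert i j; decide
  rcases hcases with rfl | rfl | rfl | rfl
  · rfl
  · exact absurd h (not_reachable_add_one hconn huni hinj hadj i)
  · exact absurd h (not_reachable_add_two hconn huni hinj hadj i)
  · exact absurd h.symm (not_reachable_add_one hconn huni hinj hadj j)

lemma isBridge_of_mem_edgeSet_deleteEdges_cycleEdges [Fintype V] (hconn : G.Connected)
    (huni : G.edgeSet.ncard = Fintype.card V) (hinj : Function.Injective v)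
    (hadj : ∀ i : ZMod 4, G.Adj (v i) (v (i + 1))) {f : Sym2 V}
    (hf : f ∈ (G.deleteEdges (cycleEdges v)).edgeSet) : G.IsBridge f := by
  rw [edgeSet_deleteEdges] at hf
  obtain ⟨hf, hfc⟩ := hf
  by_contra hb
  induction f with | h a b
  have hconn' := hconn.connected_delete_edge_of_not_isBridge hb
  have hadj' : ∀ i : ZMod 4, (G.deleteEdges {s(a, b)}).Adj (v i) (v (i + 1)) := fun i => by
    rw [deleteEdges_adj]
    exact ⟨hadj i, fun h => hfc ⟨i, h.symm⟩⟩
  have hT := hconn.isTree_deleteEdges_of_not_isBridge huni (hadj 0)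
    (not_isBridge_cycleEdge hinj hadj 0)
  have hfT : s(a, b) ∈ (G.deleteEdges {s(v 0, v (0 + 1))}).edgeSet := by
    rw [edgeSet_deleteEdges]
    exact ⟨hf, fun h => hfc ⟨0, h⟩⟩
  refine isBridge_iff.1 (isAcyclic_iff_forall_isBridge.1 hT.isAcyclic hfT) ?_
  have := (hconn'.connected_delete_edge_of_not_isBridge
    (not_isBridge_cycleEdge hinj hadj' 0)).preconnected a b
  rwa [deleteEdges_deleteEdges, Set.union_comm, ← deleteEdges_deleteEdges] at this

lemma exists_reachable_cycle (hconn : G.Connected) (u : V) :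
    ∃ i, (G.deleteEdges (cycleEdges v)).Reachable (v i) u := by
  obtain ⟨p⟩ := hconn.preconnected u (v 0)
  generalize hw : v 0 = w at p
  induction p with
  | nil => exact ⟨0, by rw [hw]⟩
  | @cons a b w h p ih =>
    obtain ⟨i, hi⟩ := ih hw
    by_cases hc : s(a, b) ∈ cycleEdges v
    · obtain ⟨j, hj⟩ := hc
      rcases Sym2.eq_iff.1 hj with ⟨rfl, -⟩ | ⟨rfl, -⟩
      · exact ⟨j, .rfl⟩
      · exact ⟨j + 1, .rfl⟩
    · exact ⟨i, hi.trans (Adj.reachable (deleteEdges_adj.2 ⟨h, hc⟩)).symm⟩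

lemma exists_walk_along_cycle (hadj : ∀ i : ZMod 4, G.Adj (v i) (v (i + 1))) (a : ZMod 4) (n : ℕ) :
    ∃ p : G.Walk (v a) (v (a + n)), ∀ e ∈ p.edges, ∃ m < n,
      e = s(v (a + (m : ℕ)), v (a + (m : ℕ) + 1)) := by
  induction n with
  | zero => exact ⟨Walk.nil.copy rfl (by simp), by simp⟩
  | succ n ih =>
    obtain ⟨p, hp⟩ := ih
    refine ⟨(p.concat (hadj _)).copy rfl (by push_cast; ring_nf), fun e he => ?_⟩
    simp only [Walk.edges_copy, Walk.edges_concat, List.concat_eq_append, List.mem_append,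
      List.mem_singleton] at he
    rcases he with he | rfl
    · obtain ⟨m, hm, h⟩ := hp e he
      exact ⟨m, by omega, h⟩
    · exact ⟨n, by omega, rfl⟩

/-- The positively oriented arc of the cycle from `v a` to `v b`. -/
lemma exists_arc (hadj : ∀ i : ZMod 4, G.Adj (v i) (v (i + 1))) (a b : ZMod 4) :
    ∃ p : G.Walk (v a) (v b), ∀ e ∈ p.edges, ∃ j : ZMod 4, (j - a).val < (b - a).val ∧
      e = s(v j, v (j + 1)) := by
  obtain ⟨p, hp⟩ := exists_walk_along_cycle hadj a (b - a).val
  refine ⟨p.copy rfl (by simp), fun e he => ?_⟩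
  rw [Walk.edges_copy] at he
  obtain ⟨m, hm, rfl⟩ := hp e he
  refine ⟨_, ?_, rfl⟩
  rw [add_sub_cancel_left, ZMod.val_natCast_of_lt (hm.trans (ZMod.val_lt _))]
  exact hm

set_option synthInstance.maxHeartbeats 200000 in
set_option synthInstance.maxSize 1000 in
lemma arc_avoids_of_const (i : ZMod 4) : ∀ a b : ZMod 4, a ≠ b → ∀ s t : Option (ZMod 4),
    (∀ j, s = some j → i = a) → (∀ j, t = some j → i = b) →
    (∀ j, (j - a).val < (b - a).val → s ≠ some j ∧ t ≠ some j) ∨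
    (∀ j, (j - b).val < (a - b).val → s ≠ some j ∧ t ≠ some j) := by
  revert i
  decide

set_option synthInstance.maxHeartbeats 200000 in
set_option synthInstance.maxSize 1000 in
lemma arc_avoids_of_three (i : ZMod 4) : ∀ a b : ZMod 4, a ≠ b → ∀ s t : Option (ZMod 4),
    (∀ j, s = some j → i + (![2, 0, 1, 1] : Fin 4 → ZMod 4) (j - i) = a) →
    (∀ j, t = some j → i + (![2, 0, 1, 1] : Fin 4 → ZMod 4) (j - i) = b) →
    (∀ j, (j - a).val < (b - a).val → s ≠ some j ∧ t ≠ some j) ∨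
    (∀ j, (j - b).val < (a - b).val → s ≠ some j ∧ t ≠ some j) := by
  revert i
  decide +kernel

/-- Coloring every edge off the cycle by itself, and the edges of the cycle by four distinct
pendant edges such that no two pendant edges block both arcs between their trees, is a rainbow
coloring. -/
lemma exists_rainbow_of_leaves [Fintype V] (hconn : G.Connected)
    (huni : G.edgeSet.ncard = Fintype.card V) (hinj : Function.Injective v)
    (hadj : ∀ i : ZMod 4, G.Adj (v i) (v (i + 1))) (k : ZMod 4 → ZMod 4) (x : ZMod 4 → V)
    (hx : Function.Injective x) (hxv : ∀ j, x j ≠ v (k j))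
    (hreach : ∀ j, (G.deleteEdges (cycleEdges v)).Reachable (v (k j)) (x j))
    (hleaf : ∀ j, ((G.deleteEdges (cycleEdges v)).neighborSet (x j)).ncard = 1)
    (harc : ∀ a b : ZMod 4, a ≠ b → ∀ s t : Option (ZMod 4), (∀ j, s = some j → k j = a) →
      (∀ j, t = some j → k j = b) →
      (∀ j, (j - a).val < (b - a).val → s ≠ some j ∧ t ≠ some j) ∨
      (∀ j, (j - b).val < (a - b).val → s ≠ some j ∧ t ≠ some j)) :
    ∃ c : Sym2 V → Sym2 V, IsRainbowConnected G c ∧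
      ∀ e ∈ G.edgeSet, c e ∈ (G.deleteEdges (cycleEdges v)).edgeSet := by
  classical
  set H := G.deleteEdges (cycleEdges v) with hH
  have hsep : ∀ {i j}, H.Reachable (v i) (v j) → i = j :=
    eq_of_reachable_deleteEdges_cycleEdges hconn huni hinj hadj
  have hnb : ∀ j, ∃ y, H.Adj (x j) y ∧ ∀ z, H.Adj (x j) z → z = y := fun j => by
    obtain ⟨y, hy⟩ := Set.ncard_eq_one.1 (hleaf j)
    have hy' : ∀ z, H.Adj (x j) z ↔ z = y := fun z => by
      rw [← mem_neighborSet, hy, Set.mem_singleton_iff]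
    exact ⟨y, (hy' y).2 rfl, fun z => (hy' z).1⟩
  choose y hy hyu using hnb
  -- a path starting on the cycle that uses a pendant edge ends in its leaf
  have hend : ∀ {a u} {p : H.Walk (v a) u}, p.IsPath → ∀ j, s(x j, y j) ∈ p.edges →
      x j = u ∧ k j = a := by
    intro a u p hp j hj
    have hka : k j = a :=
      hsep ((hreach j).trans ⟨(p.takeUntil _ (p.fst_mem_support_of_mem_edges hj)).reverse⟩)
    exact ⟨hp.eq_of_leaf_mem_edges (hyu j) (hka ▸ hxv j) hj, hka⟩
  have hf : Function.Injective fun j => s(x j, y j) := by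
    intro i j hij
    obtain ⟨p, hp⟩ := (hreach i).exists_isPath
    have h1 := p.leaf_mem_edges (hyu i) (hxv i)
    rw [show s(x i, y i) = s(x j, y j) from hij] at h1
    exact (hx (hend hp j h1).1).symm
  obtain ⟨c, hcE, hcH⟩ : ∃ c : Sym2 V → Sym2 V,
      (∀ j, c s(v j, v (j + 1)) = s(x j, y j)) ∧ ∀ e ∉ cycleEdges v, c e = e := by
    refine ⟨fun e => if h : e ∈ cycleEdges v then s(x h.choose, y h.choose) else e,
      fun j => ?_, fun e he => dif_neg he⟩
    have h : s(v j, v (j + 1)) ∈ cycleEdges v := ⟨j, rfl⟩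
    have : h.choose = j := (cycleEdge_injective hinj h.choose_spec).symm
    simp only [dif_pos h, this]
  have hcH' : ∀ e ∈ H.edgeSet, c e = e := fun e he =>
    hcH e (by rw [hH, edgeSet_deleteEdges] at he; exact he.2)
  have hle : H ≤ G := deleteEdges_le _
  refine ⟨c, fun u w => ?_, fun e he => ?_⟩
  swap
  · by_cases hc : e ∈ cycleEdges v
    · obtain ⟨j, rfl⟩ := hc
      rw [hcE]
      exact hy j
    · rw [hcH e hc, hH, edgeSet_deleteEdges]
      exact ⟨he, hc⟩
  obtain ⟨a, ha⟩ := exists_reachable_cycle (v := v) hconn u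
  obtain ⟨b, hb⟩ := exists_reachable_cycle (v := v) hconn w
  obtain ⟨p, hp⟩ := ha.exists_isPath
  obtain ⟨q, hq⟩ := hb.exists_isPath
  by_cases hab : a = b
  · subst hab
    refine ((p.reverse.append q).mapLe hle).exists_rainbow_path fun e he f hf hef => ?_
    simp only [Set.mem_ofPred_eq, Walk.edges_mapLe_eq_edges] at he hf
    rwa [hcH' e (Walk.edges_subset_edgeSet _ he), hcH' f (Walk.edges_subset_edgeSet _ hf)] at hef
  -- an arc avoiding the pendant edges used by `p` and `q` completes a rainbow walk
  have key : ∀ r : G.Walk (v a) (v b), (∀ e ∈ r.edges, ∃ j, e = s(v j, v (j + 1)) ∧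
      s(x j, y j) ∉ p.edges ∧ s(x j, y j) ∉ q.edges) →
      ∃ p : G.Walk u w, p.IsPath ∧ (p.edges.map c).Nodup := by
    intro r hr
    refine (((p.reverse.mapLe hle).append r).append (q.mapLe hle)).exists_rainbow_path ?_
    have hmem : ∀ e, e ∈ (((p.reverse.mapLe hle).append r).append (q.mapLe hle)).edges →
        ((e ∈ p.edges ∨ e ∈ q.edges) ∧ c e = e) ∨
        ∃ j, e = s(v j, v (j + 1)) ∧ s(x j, y j) ∉ p.edges ∧ s(x j, y j) ∉ q.edges := by
      intro e he
      simp only [Walk.edges_append, Walk.edges_mapLe_eq_edges, Walk.edges_reverse,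
        List.mem_append, List.mem_reverse] at he
      rcases he with (he | he) | he
      · exact .inl ⟨.inl he, hcH' e (Walk.edges_subset_edgeSet _ he)⟩
      · exact .inr (hr e he)
      · exact .inl ⟨.inr he, hcH' e (Walk.edges_subset_edgeSet _ he)⟩
    intro e he f hf' hef
    rcases hmem e he with ⟨he, hce⟩ | ⟨i, rfl, hi⟩ <;>
      rcases hmem f hf' with ⟨hf', hcf⟩ | ⟨j, rfl, hj⟩
    · rwa [hce, hcf] at hef
    · rw [hce, hcE] at hef
      subst hef
      tauto
    · rw [hcf, hcE] at hef
      subst hef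
      tauto
    · rw [hcE, hcE] at hef
      rw [hf hef]
  have hblock : ∀ {a u} {p : H.Walk (v a) u}, p.IsPath → ∃ s : Option (ZMod 4),
      (∀ j, s = some j → k j = a) ∧ ∀ j, s ≠ some j → s(x j, y j) ∉ p.edges := by
    intro a u p hp
    by_cases h : ∃ j, s(x j, y j) ∈ p.edges
    · obtain ⟨i, hi⟩ := h
      refine ⟨some i, fun j hj => ?_, fun j hj hj' => hj ?_⟩
      · cases hj
        exact (hend hp _ hi).2
      · exact congrArg some (hx ((hend hp _ hi).1.trans (hend hp _ hj').1.symm))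
    · exact ⟨none, by simp, fun j _ hj => h ⟨j, hj⟩⟩
  obtain ⟨s, hs, hs'⟩ := hblock hp
  obtain ⟨t, ht, ht'⟩ := hblock hq
  rcases harc a b hab s t hs ht with h | h
  · obtain ⟨r, hr⟩ := exists_arc hadj a b
    refine key r fun e he => ?_
    obtain ⟨j, hj, rfl⟩ := hr e he
    exact ⟨j, rfl, hs' j (h j hj).1, ht' j (h j hj).2⟩
  · obtain ⟨r, hr⟩ := exists_arc hadj b a
    refine key r.reverse fun e he => ?_
    rw [Walk.edges_reverse, List.mem_reverse] at he
    obtain ⟨j, hj, rfl⟩ := hr e he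
    exact ⟨j, rfl, hs' j (h j hj).1, ht' j (h j hj).2⟩

end FourCycle

lemma Set.exists_injective_fin_of_le_ncard {α : Type*} {s : Set α} {n : ℕ} (hn : 0 < n)
    (h : n ≤ s.ncard) : ∃ x : Fin n → α, Function.Injective x ∧ ∀ j, x j ∈ s := by
  have hfin : s.Finite := Set.finite_of_ncard_pos (hn.trans_le h)
  have := hfin.fintype
  have hc : Fintype.card (Fin n) ≤ Fintype.card s := by
    rwa [Fintype.card_fin, ← Nat.card_eq_fintype_card, Nat.card_coe_set_eq]
  obtain ⟨g⟩ := Function.Embedding.nonempty_of_card_le hc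
  exact ⟨fun j => g j, Subtype.val_injective.comp g.injective, fun j => (g j).2⟩

/-- Let `G` be a connected unicyclic graph with m edges whose unique
cycle `v₁v₂v₃v₄v₁` has length 4. If for some index `i` (mod 4), either `l(vᵢ) ≥ 4`,
or `l(vᵢ) ≥ 1`, `l(v_{i+1}) ≥ 2` and `l(v_{i+2}) ≥ 1`, then rc(G) = m − 4. -/
theorem stmt_11 {V : Type*} [Fintype V] (G : SimpleGraph V)
    (hconn : G.Connected) (huni : G.edgeSet.ncard = Fintype.card V)
    (v : ZMod 4 → V) (hinj : Function.Injective v)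
    (hadj : ∀ i : ZMod 4, G.Adj (v i) (v (i + 1)))
    (hl : ∃ i : ZMod 4, 4 ≤ numLeaves G v i ∨
      (1 ≤ numLeaves G v i ∧ 2 ≤ numLeaves G v (i + 1) ∧ 1 ≤ numLeaves G v (i + 2))) :
    rc G = G.edgeSet.ncard - 4 := by
  set H := G.deleteEdges (cycleEdges v) with hH
  have hsub : cycleEdges v ⊆ G.edgeSet := by
    rintro e ⟨i, rfl⟩
    exact hadj i
  have hcard : H.edgeSet.ncard = G.edgeSet.ncard - 4 := by
    rw [hH, edgeSet_deleteEdges, Set.ncard_sdiff hsub, ncard_cycleEdges hinj]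
  rw [← hcard]
  have hsep : ∀ {i j}, H.Reachable (v i) (v j) → i = j :=
    eq_of_reachable_deleteEdges_cycleEdges hconn huni hinj hadj
  obtain ⟨c, hc, hcH⟩ : ∃ c : Sym2 V → Sym2 V, IsRainbowConnected G c ∧
      ∀ e ∈ G.edgeSet, c e ∈ H.edgeSet := by
    obtain ⟨i, h4 | ⟨h0, h1, h2⟩⟩ := hl
    · obtain ⟨x, hx, hxs⟩ := Set.exists_injective_fin_of_le_ncard (by norm_num) h4
      refine exists_rainbow_of_leaves hconn huni hinj hadj (fun _ => i) x hx
        (fun j => (hxs j).1) (fun j => (hxs j).2.1) (fun j => (hxs j).2.2) (arc_avoids_of_const i)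
    · obtain ⟨p, -, hp⟩ := Set.exists_injective_fin_of_le_ncard (by norm_num) h0
      obtain ⟨q, hq, hqs⟩ := Set.exists_injective_fin_of_le_ncard (by norm_num) h1
      obtain ⟨r, -, hr⟩ := Set.exists_injective_fin_of_le_ncard (by norm_num) h2
      let k : ZMod 4 → ZMod 4 := (![2, 0, 1, 1] : Fin 4 → ZMod 4)
      let x : ZMod 4 → V := ![r 0, p 0, q 0, q 1]
      have hxs : ∀ j, x j ≠ v (i + k j) ∧ H.Reachable (v (i + k j)) (x j) ∧
          (H.neighborSet (x j)).ncard = 1 := by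
        intro j
        fin_cases j
        · exact hr 0
        · have := hp 0
          rw [← add_zero i] at this
          exact this
        · exact hqs 0
        · exact hqs 1
      have hx : Function.Injective x := by
        intro j l hjl
        have hkk : k j = k l := add_left_cancel
          (hsep ((hxs j).2.1.trans (by rw [hjl]; exact (hxs l).2.1.symm)))
        have hcases : j = l ∨ j = 2 ∧ l = 3 ∨ j = 3 ∧ l = 2 := by
          have : ∀ j l : Fin 4, (![2, 0, 1, 1] : Fin 4 → ZMod 4) j =
              (![2, 0, 1, 1] : Fin 4 → ZMod 4) l → j = l ∨ j = 2 ∧ l = 3 ∨ j = 3 ∧ l = 2 := by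
            decide
          exact this j l hkk
        rcases hcases with h | ⟨rfl, rfl⟩ | ⟨rfl, rfl⟩
        · exact h
        · exact absurd (hq hjl) (by decide)
        · exact absurd (hq hjl) (by decide)
      exact exists_rainbow_of_leaves hconn huni hinj hadj (fun j => i + k (j - i))
        (fun j => x (j - i)) (hx.comp sub_left_injective) (fun j => (hxs _).1)
        (fun j => (hxs _).2.1) (fun j => (hxs _).2.2) (arc_avoids_of_three i)
  have hmem : H.edgeSet.ncard ∈ {k : ℕ | ∃ c : Sym2 V → Fin k, IsRainbowConnected G c} := by
    have e : H.edgeSet ≃ Fin H.edgeSet.ncard := Finite.equivFin _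
    have hne : G.edgeSet.Nonempty := ⟨s(v 0, v (0 + 1)), hadj 0⟩
    obtain ⟨e₀, he₀⟩ := hne
    let d : Sym2 V → Fin H.edgeSet.ncard := fun f =>
      open Classical in if h : c f ∈ H.edgeSet then e ⟨c f, h⟩ else e ⟨c e₀, hcH e₀ he₀⟩
    refine ⟨d, fun u w => ?_⟩
    obtain ⟨p, hp, hpc⟩ := hc u w
    refine ⟨p, hp, List.Nodup.map_on (fun f hf g hg hfg => ?_) hp.isTrail.edges_nodup⟩
    have hf' := hcH f (p.edges_subset_edgeSet hf)
    have hg' := hcH g (p.edges_subset_edgeSet hg)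
    simp only [d, dif_pos hf', dif_pos hg', EmbeddingLike.apply_eq_iff_eq, Subtype.mk.injEq] at hfg
    exact List.inj_on_of_nodup_map hpc hf hg hfg
  refine le_antisymm (Nat.sInf_le hmem) (le_csInf ⟨_, hmem⟩ ?_)
  rintro n ⟨d, hd⟩
  have hbridge : ∀ e ∈ H.edgeSet, e ∈ {e | e ∈ G.edgeSet ∧ G.IsBridge e} := fun e he =>
    ⟨edgeSet_mono (deleteEdges_le _) he,
      isBridge_of_mem_edgeSet_deleteEdges_cycleEdges hconn huni hinj hadj he⟩
  have hinjd : Set.InjOn d H.edgeSet := hd.injOn_bridges.mono hbridge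
  rw [← hinjd.ncard_image]
  simpa using Set.ncard_le_card (d '' H.edgeSet)
end

section
/- Let G be a connected unicyclic graph with m edges whose unique cycle C = v₁v₂v₃v₄v₅v₆v₁ has length 6 (girth 6). If there is an index i (mod 6) with l(vᵢ) ≤ 1, l(v_{i+3}) ≤ 1 and l(v_{i+1}) = l(v_{i+2}) = l(v_{i+4}) = l(v_{i+5}) = 0, then rc(G) = m − 3. -/
namespace SimpleGraph

variable {V : Type*}

/-- A graph in which every vertex is reachable from `S` has at most `|S|` components, hence at
least `|V| - |S|` edges. -/
lemma card_le_ncard_edgeSet_add_ncard [Fintype V] (H : SimpleGraph V) (S : Set V)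
    (hS : ∀ x, ∃ r ∈ S, H.Reachable r x) :
    Fintype.card V ≤ H.edgeSet.ncard + S.ncard := by
  rcases isEmpty_or_nonempty V with hV | ⟨⟨x⟩⟩
  · simp
  obtain ⟨r₀, hr₀, -⟩ := hS x
  set F : Set (Sym2 V) := (fun r => s(r₀, r)) '' (S \ {r₀}) with hF
  have hroot : ∀ r ∈ S, (H ⊔ fromEdgeSet F).Reachable r₀ r := by
    intro r hr
    by_cases h : r = r₀
    · subst h; rfl
    · refine Adj.reachable (Or.inr ?_)
      rw [fromEdgeSet_adj]
      exact ⟨⟨r, ⟨hr, h⟩, rfl⟩, Ne.symm h⟩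
  have hreach : ∀ y, (H ⊔ fromEdgeSet F).Reachable r₀ y := by
    intro y
    obtain ⟨r, hr, hry⟩ := hS y
    exact (hroot r hr).trans (hry.mono le_sup_left)
  have hconn : (H ⊔ fromEdgeSet F).Connected :=
    (connected_iff _).2 ⟨fun a b => (hreach a).symm.trans (hreach b), ⟨x⟩⟩
  have h1 := hconn.card_vert_le_card_edgeSet_add_one
  rw [Nat.card_eq_fintype_card, Nat.card_coe_set_eq, edgeSet_sup, edgeSet_fromEdgeSet] at h1
  have h2 : (F \ Sym2.diagSet).ncard ≤ F.ncard := Set.ncard_le_ncard Set.sdiff_subset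
  have h3 : F.ncard ≤ (S \ {r₀}).ncard := Set.ncard_image_le
  have h4 := Set.ncard_sdiff_singleton_add_one hr₀
  have h5 := Set.ncard_union_le H.edgeSet (F \ Sym2.diagSet)
  omega

lemma IsAcyclic.isPath_unique {H : SimpleGraph V} (hH : H.IsAcyclic) {a b : V}
    {p q : H.Walk a b} (hp : p.IsPath) (hq : q.IsPath) : p = q :=
  congrArg Subtype.val ((hH.subsingleton_path a b).elim ⟨p, hp⟩ ⟨q, hq⟩)

/-- In a finite forest, every vertex reachable from a root `r` lies on a path from `r` to a leaf. -/
lemma IsAcyclic.exists_isPath_to_leaf [Fintype V] {H : SimpleGraph V} (hH : H.IsAcyclic)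
    {r y : V} (hy : H.Reachable r y) (hne : y ≠ r) :
    ∃ x, x ≠ r ∧ (H.neighborSet x).ncard = 1 ∧ ∃ p : H.Walk r x, p.IsPath ∧ y ∈ p.support := by
  classical
  set L : Set ℕ := {n | ∃ x, ∃ p : H.Walk r x, p.IsPath ∧ y ∈ p.support ∧ p.length = n} with hL
  have hfin : L.Finite := by
    refine (Set.finite_lt_nat (Fintype.card V)).subset ?_
    rintro n ⟨x, p, hp, -, rfl⟩
    exact hp.length_lt
  have hnonempty : L.Nonempty := by
    obtain ⟨p, hp, -⟩ := hy.exists_path_of_dist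
    exact ⟨_, y, p, hp, p.end_mem_support, rfl⟩
  obtain ⟨n, ⟨x, p, hp, hyp, rfl⟩, hmax⟩ := hfin.exists_maximal hnonempty
  have hxr : x ≠ r := by
    rintro rfl
    obtain rfl := (Walk.isPath_iff_nil.1 hp).eq_nil
    exact hne (by simpa using hyp)
  refine ⟨x, hxr, ?_, p, hp, hyp⟩
  rw [Set.ncard_eq_one]
  refine ⟨p.penultimate, Set.eq_singleton_iff_unique_mem.2 ⟨?_, ?_⟩⟩
  · exact (p.adj_penultimate (Walk.not_nil_of_ne hxr.symm)).symm
  · intro z hz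
    refine hH.eq_penultimate_of_adj_end hp hz ?_
    by_contra hzp
    have := hmax (y := p.length + 1) ⟨z, p.concat hz, hp.concat hzp hz,
      p.support_subset_support_concat hz hyp, p.length_concat hz⟩ (Nat.le_succ _)
    omega

/-- In a finite forest, the component of a root with at most one leaf is a path. -/
lemma IsAcyclic.exists_ncard_reachable_le_dist [Fintype V] {H : SimpleGraph V} (hH : H.IsAcyclic)
    (r : V) (hleaf :
      {x | x ≠ r ∧ H.Reachable r x ∧ (H.neighborSet x).ncard = 1}.ncard ≤ 1) :
    ∃ x, H.Reachable r x ∧ {y | H.Reachable r y}.ncard ≤ H.dist r x + 1 := by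
  classical
  rw [Set.ncard_le_one_iff] at hleaf
  by_cases h : ∃ y, H.Reachable r y ∧ y ≠ r
  · obtain ⟨y, hy, hyr⟩ := h
    obtain ⟨x, hxr, hx, p, hp, -⟩ := hH.exists_isPath_to_leaf hy hyr
    refine ⟨x, p.reachable, ?_⟩
    obtain ⟨q, hq, hqd⟩ := p.reachable.exists_path_of_dist
    have hsub : {z | H.Reachable r z} ⊆ (q.support.toFinset : Set V) := by
      intro z hz
      rw [List.coe_toFinset]
      by_cases hzr : z = r
      · subst hzr; exact q.start_mem_support
      · obtain ⟨x', hxr', hx', p', hp', hzp⟩ := hH.exists_isPath_to_leaf hz hzr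
        obtain rfl : x' = x := hleaf ⟨hxr', p'.reachable, hx'⟩ ⟨hxr, p.reachable, hx⟩
        rwa [hH.isPath_unique hq hp']
    calc _ ≤ (q.support.toFinset : Set V).ncard := Set.ncard_le_ncard hsub
      _ ≤ q.support.length := by
          rw [Set.ncard_coe_finset]; exact List.toFinset_card_le _
      _ = H.dist r x + 1 := by rw [q.length_support, hqd]
  · push Not at h
    refine ⟨r, .rfl, ?_⟩
    rw [dist_self, zero_add, Set.ncard_le_one_iff]
    intro a b ha hb
    rw [h a ha, h b hb]

/-- A forest vertex without leaves hanging off it is isolated. -/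
lemma IsAcyclic.ncard_reachable_le_one [Fintype V] {H : SimpleGraph V} (hH : H.IsAcyclic)
    (r : V) (hleaf :
      {x | x ≠ r ∧ H.Reachable r x ∧ (H.neighborSet x).ncard = 1}.ncard = 0) :
    {y | H.Reachable r y}.ncard ≤ 1 := by
  have hempty := (Set.ncard_eq_zero).1 hleaf
  have hr : ∀ y, H.Reachable r y → y = r := by
    intro y hy
    by_contra hyr
    obtain ⟨x, hxr, hx, p, -⟩ := hH.exists_isPath_to_leaf hy hyr
    exact Set.notMem_empty x (hempty ▸ ⟨hxr, p.reachable, hx⟩)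
  rw [Set.ncard_le_one_iff]
  intro a b ha hb
  rw [hr a ha, hr b hb]

lemma Walk.sub_le_length {G : SimpleGraph V} (f : V → ℤ)
    (hf : ∀ a b, G.Adj a b → f b - f a ≤ 1) {a b : V} (p : G.Walk a b) :
    f b - f a ≤ p.length := by
  induction p with
  | nil => simp
  | cons h p ih =>
    have := hf _ _ h
    rw [Walk.length_cons]
    push_cast
    omega

end SimpleGraph

section Coloring

variable {V α : Type*} {G : SimpleGraph V}

lemma isRainbowConnected_of_walk {c : Sym2 V → α}
    (h : ∀ u w : V, ∃ p : G.Walk u w, (p.edges.map c).Nodup) : IsRainbowConnected G c := by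
  classical
  intro u w
  obtain ⟨p, hp⟩ := h u w
  exact ⟨p.bypass, p.bypass_isPath, hp.sublist (p.edges_bypass_sublist_edges.map c)⟩

lemma IsRainbowConnected.exists_walk_length_le {k : ℕ} {c : Sym2 V → Fin k}
    (h : IsRainbowConnected G c) (u w : V) : ∃ p : G.Walk u w, p.length ≤ k := by
  obtain ⟨p, -, hp⟩ := h u w
  exact ⟨p, by simpa using hp.length_le_card⟩

end Coloring

section Hexagon

variable {V : Type*} {G : SimpleGraph V} {v : ZMod 6 → V}

lemma hexagon_edge_injective (hinj : Function.Injective v) :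
    Function.Injective fun j : ZMod 6 => s(v j, v (j + 1)) := by
  intro j k h
  have hdec : ∀ j k : ZMod 6, (j = k ∧ j + 1 = k + 1) ∨ (j = k + 1 ∧ j + 1 = k) → j = k := by
    decide
  simp only [Sym2.eq_iff, hinj.eq_iff] at h
  exact hdec j k h

lemma ncard_cycleEdges_hexagon (hinj : Function.Injective v) : (cycleEdges v).ncard = 6 := by
  have h : cycleEdges v = Set.range fun j : ZMod 6 => s(v j, v (j + 1)) := by
    ext e
    simp [cycleEdges, eq_comm]
  rw [h, ← Set.image_univ, Set.ncard_image_of_injective _ (hexagon_edge_injective hinj),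
    Set.ncard_univ, Nat.card_eq_fintype_card, ZMod.card]

lemma cycleEdges_subset_edgeSet {s : ℕ} {v : ZMod s → V} (hadj : ∀ i, G.Adj (v i) (v (i + 1))) :
    cycleEdges v ⊆ G.edgeSet := by
  rintro e ⟨i, rfl⟩
  exact hadj i

/-- After deleting the edges of the cycle, every vertex is still joined to a cycle vertex. -/
lemma exists_reachable_deleteEdges_cycleEdges {s : ℕ} {v : ZMod s → V} (hconn : G.Connected)
    (x : V) : ∃ j, (G.deleteEdges (cycleEdges v)).Reachable (v j) x := by
  obtain ⟨p⟩ := hconn.preconnected (v 0) x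
  have key : ∀ {a b : V}, G.Walk a b →
      (∃ j, (G.deleteEdges (cycleEdges v)).Reachable (v j) a) →
      ∃ j, (G.deleteEdges (cycleEdges v)).Reachable (v j) b := by
    intro a b p
    induction p with
    | nil => exact id
    | @cons a a' b h p ih =>
      rintro ⟨j, hj⟩
      apply ih
      by_cases he : s(a, a') ∈ cycleEdges v
      · obtain ⟨i, hi⟩ := he
        rcases Sym2.eq_iff.1 hi with ⟨-, rfl⟩ | ⟨-, rfl⟩
        · exact ⟨_, .rfl⟩
        · exact ⟨_, .rfl⟩
      · exact ⟨j, hj.trans (SimpleGraph.deleteEdges_adj.2 ⟨h, he⟩).reachable⟩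
  exact key p ⟨0, .rfl⟩

lemma ncard_range_hexagon (hinj : Function.Injective v) : (Set.range v).ncard = 6 := by
  rw [← Set.image_univ, Set.ncard_image_of_injective _ hinj,
    Set.ncard_univ, Nat.card_eq_fintype_card, ZMod.card]

/-- Under a coloring in which only opposite hexagon edges share colors, any two hexagon vertices
are joined by a rainbow walk along the hexagon. -/
lemma exists_rainbow_walk_hexagon {α : Type*} {c : Sym2 V → α} (hinj : Function.Injective v)
    (hadj : ∀ i, G.Adj (v i) (v (i + 1)))
    (hc : ∀ e ∈ G.edgeSet, ∀ e' ∈ G.edgeSet, c e = c e' →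
      e = e' ∨ ∃ j : ZMod 6, e = s(v j, v (j + 1)) ∧ e' = s(v (j + 3), v (j + 3 + 1)))
    (j k : ZMod 6) :
    ∃ p : G.Walk (v j) (v k), (∀ e ∈ p.edges, e ∈ cycleEdges v) ∧ (p.edges.map c).Nodup := by
  have hE := hexagon_edge_injective hinj
  have hne : ∀ a b : ZMod 6, a ≠ b → a + 3 ≠ b →
      c s(v a, v (a + 1)) ≠ c s(v b, v (b + 1)) := by
    intro a b hab hab' h
    rcases hc _ (hadj a) _ (hadj b) h with h | ⟨i, hi, hi'⟩
    · exact hab (hE h)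
    · exact hab' (by rw [hE hi, ← hE hi'])
  have forward : ∀ j : ZMod 6, ∀ t ∈ ({0, 1, 2, 3} : Finset (ZMod 6)),
      ∃ p : G.Walk (v j) (v (j + t)),
        (∀ e ∈ p.edges, e ∈ cycleEdges v) ∧ (p.edges.map c).Nodup := by
    intro j t ht
    have h2 : j + 1 + 1 = j + 2 := by ring
    have h3 : j + 1 + 1 + 1 = j + 3 := by ring
    have hdec : ∀ j : ZMod 6, (j ≠ j + 1 ∧ j + 3 ≠ j + 1) ∧
        (j ≠ j + 1 + 1 ∧ j + 3 ≠ j + 1 + 1) := by decide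
    have n1 := hne j (j + 1) (hdec j).1.1 (hdec j).1.2
    have n2 := hne j (j + 1 + 1) (hdec j).2.1 (hdec j).2.2
    have n3 := hne (j + 1) (j + 1 + 1) (hdec (j + 1)).1.1 (hdec (j + 1)).1.2
    fin_cases ht
    · exact ⟨SimpleGraph.Walk.nil.copy rfl (by simp), by simp, by simp⟩
    · refine ⟨.cons (hadj j) .nil, ?_, by simp⟩
      simp only [SimpleGraph.Walk.edges_cons, SimpleGraph.Walk.edges_nil, List.mem_singleton]
      rintro e rfl
      exact ⟨_, rfl⟩
    · refine ⟨(SimpleGraph.Walk.cons (hadj j) (.cons (hadj (j + 1)) .nil)).copy rfl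
        (by rw [h2]), ?_, ?_⟩
      · simp only [SimpleGraph.Walk.edges_copy, SimpleGraph.Walk.edges_cons,
          SimpleGraph.Walk.edges_nil, List.mem_cons, List.not_mem_nil, or_false]
        rintro e (rfl | rfl)
        exacts [⟨_, rfl⟩, ⟨_, rfl⟩]
      · simpa using n1
    · refine ⟨(SimpleGraph.Walk.cons (hadj j) (.cons (hadj (j + 1))
        (.cons (hadj (j + 1 + 1)) .nil))).copy rfl (by rw [h3]), ?_, ?_⟩
      · simp only [SimpleGraph.Walk.edges_copy, SimpleGraph.Walk.edges_cons,
          SimpleGraph.Walk.edges_nil, List.mem_cons, List.not_mem_nil, or_false]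
        rintro e (rfl | rfl | rfl)
        exacts [⟨_, rfl⟩, ⟨_, rfl⟩, ⟨_, rfl⟩]
      · simpa using ⟨⟨n1, n2⟩, n3⟩
  have hdec : ∀ j k : ZMod 6, (∃ t ∈ ({0, 1, 2, 3} : Finset (ZMod 6)), k = j + t) ∨
      ∃ t ∈ ({0, 1, 2, 3} : Finset (ZMod 6)), j = k + t := by decide
  rcases hdec j k with ⟨t, ht, rfl⟩ | ⟨t, ht, rfl⟩
  · exact forward j t ht
  · obtain ⟨p, hp, hp'⟩ := forward k t ht
    refine ⟨p.reverse, by simpa using hp, ?_⟩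
    rw [SimpleGraph.Walk.edges_reverse, List.map_reverse, List.nodup_reverse]
    exact hp'

variable [Fintype V]

lemma ncard_edgeSet_deleteEdges_hexagon (huni : G.edgeSet.ncard = Fintype.card V)
    (hinj : Function.Injective v) (hadj : ∀ i, G.Adj (v i) (v (i + 1))) :
    (G.deleteEdges (cycleEdges v)).edgeSet.ncard + 6 = Fintype.card V := by
  have h := Set.ncard_sdiff_add_ncard_of_subset (cycleEdges_subset_edgeSet hadj)
  rw [ncard_cycleEdges_hexagon hinj, huni] at h
  rwa [SimpleGraph.edgeSet_deleteEdges]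

lemma isAcyclic_deleteEdges_hexagon (hconn : G.Connected)
    (huni : G.edgeSet.ncard = Fintype.card V) (hinj : Function.Injective v)
    (hadj : ∀ i, G.Adj (v i) (v (i + 1))) : (G.deleteEdges (cycleEdges v)).IsAcyclic := by
  rw [SimpleGraph.isAcyclic_iff_forall_adj_isBridge]
  intro a b hab
  by_contra hbr
  rw [SimpleGraph.isBridge_iff, not_not] at hbr
  set H := G.deleteEdges (cycleEdges v) with hH
  have hmono : ∀ {x y}, H.Reachable x y → (H.deleteEdges {s(a, b)}).Reachable x y := by
    rintro x y ⟨p⟩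
    induction p with
    | nil => rfl
    | @cons x x' y h p ih =>
      refine SimpleGraph.Reachable.trans ?_ ih
      by_cases he : s(x, x') = s(a, b)
      · rcases Sym2.eq_iff.1 he with ⟨rfl, rfl⟩ | ⟨rfl, rfl⟩
        · exact hbr
        · exact hbr.symm
      · exact (SimpleGraph.deleteEdges_adj.2 ⟨h, he⟩).reachable
  have hcard := (H.deleteEdges {s(a, b)}).card_le_ncard_edgeSet_add_ncard (Set.range v) (by
    intro x
    obtain ⟨j, hj⟩ := exists_reachable_deleteEdges_cycleEdges (v := v) hconn x
    exact ⟨v j, ⟨j, rfl⟩, hmono hj⟩)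
  have h1 := Set.ncard_sdiff_singleton_add_one (show s(a, b) ∈ H.edgeSet from hab)
  have h2 := ncard_edgeSet_deleteEdges_hexagon huni hinj hadj
  rw [← hH] at h2
  rw [SimpleGraph.edgeSet_deleteEdges, ncard_range_hexagon hinj] at hcard
  omega

/-- After deleting the edges of the cycle, distinct cycle vertices lie in distinct components. -/
lemma eq_of_reachable_deleteEdges_hexagon (hconn : G.Connected)
    (huni : G.edgeSet.ncard = Fintype.card V) (hinj : Function.Injective v)
    (hadj : ∀ i, G.Adj (v i) (v (i + 1))) {j k : ZMod 6}
    (hjk : (G.deleteEdges (cycleEdges v)).Reachable (v j) (v k)) : j = k := by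
  by_contra hne
  have hcard := (G.deleteEdges (cycleEdges v)).card_le_ncard_edgeSet_add_ncard
    (Set.range v \ {v k}) (by
      intro x
      obtain ⟨i, hi⟩ := exists_reachable_deleteEdges_cycleEdges (v := v) hconn x
      by_cases hik : i = k
      · subst hik
        exact ⟨v j, ⟨⟨j, rfl⟩, fun h => hne (hinj h)⟩, hjk.trans hi⟩
      · exact ⟨v i, ⟨⟨i, rfl⟩, fun h => hik (hinj h)⟩, hi⟩)
  have h1 := Set.ncard_sdiff_singleton_add_one (Set.mem_range_self k : v k ∈ Set.range v)
  have h2 := ncard_edgeSet_deleteEdges_hexagon huni hinj hadj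
  rw [ncard_range_hexagon hinj] at h1
  omega

/-- Opposite edges of the hexagon may share their color, which saves three colors. -/
lemma exists_coloring_hexagon (huni : G.edgeSet.ncard = Fintype.card V)
    (hinj : Function.Injective v) (hadj : ∀ i, G.Adj (v i) (v (i + 1))) :
    ∃ c : Sym2 V → Fin (G.edgeSet.ncard - 3), ∀ e ∈ G.edgeSet, ∀ e' ∈ G.edgeSet, c e = c e' →
      e = e' ∨ ∃ j : ZMod 6, e = s(v j, v (j + 1)) ∧ e' = s(v (j + 3), v (j + 3 + 1)) := by
  classical
  have hE := hexagon_edge_injective hinj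
  set E : ZMod 6 → Sym2 V := fun j => s(v j, v (j + 1)) with hEdef
  set D : Set (Sym2 V) := E '' {3, 4, 5} with hD
  have hDsub : D ⊆ G.edgeSet := by
    rintro _ ⟨j, -, rfl⟩
    exact hadj j
  have hDcard : D.ncard = 3 := by
    rw [hD, Set.ncard_image_of_injective _ hE, Set.ncard_eq_toFinset_card']
    decide
  have hScard : (G.edgeSet \ D).ncard = G.edgeSet.ncard - 3 := by
    rw [Set.ncard_sdiff hDsub, hDcard]
  have hpos : 0 < G.edgeSet.ncard - 3 := by
    have := ncard_edgeSet_deleteEdges_hexagon huni hinj hadj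
    omega
  let φ : ↥(G.edgeSet \ D) ≃ Fin (G.edgeSet.ncard - 3) :=
    Finite.equivFinOfCardEq (by rw [Nat.card_coe_set_eq, hScard])
  have hq : ∀ e ∈ G.edgeSet, ∃ e' ∈ G.edgeSet \ D,
      e' = e ∨ ∃ j : ZMod 6, e = E (j + 3) ∧ e' = E j := by
    intro e he
    by_cases heD : e ∈ D
    · obtain ⟨j, hj, rfl⟩ := heD
      refine ⟨E (j + 3), ⟨hadj (j + 3), ?_⟩, Or.inr ⟨j + 3, ?_, rfl⟩⟩
      · rintro ⟨k, hk, hkj⟩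
        have hdec : ∀ j ∈ ({3, 4, 5} : Set (ZMod 6)), j + 3 ∉ ({3, 4, 5} : Set (ZMod 6)) := by
          decide
        exact hdec j hj (hE hkj ▸ hk)
      · have : ∀ j : ZMod 6, j = j + 3 + 3 := by decide
        rw [← this j]
    · exact ⟨e, ⟨he, heD⟩, Or.inl rfl⟩
  choose! q hqS hq using hq
  refine ⟨fun e => if h : q e ∈ G.edgeSet \ D then φ ⟨q e, h⟩ else ⟨0, hpos⟩, ?_⟩
  intro e he e' he' hcc
  simp only [dif_pos (hqS e he), dif_pos (hqS e' he')] at hcc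
  have hqq : q e = q e' := congrArg Subtype.val (φ.injective hcc)
  have h6 : ∀ j : ZMod 6, j + 3 + 3 = j := by decide
  rcases hq e he with h | ⟨j, hj, hj'⟩ <;> rcases hq e' he' with h' | ⟨k, hk, hk'⟩
  · exact Or.inl (by rw [← h, ← h', hqq])
  · exact Or.inr ⟨k, by rw [← h, hqq, hk'], hk⟩
  · refine Or.inr ⟨j + 3, hj, ?_⟩
    rw [h6, ← h', ← hqq, hj']
  · left
    rw [hj, hk, hE (hj'.symm.trans (hqq.trans hk'))]

lemma isRainbowConnected_hexagon {α : Type*} {c : Sym2 V → α} (hconn : G.Connected)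
    (huni : G.edgeSet.ncard = Fintype.card V) (hinj : Function.Injective v)
    (hadj : ∀ i, G.Adj (v i) (v (i + 1)))
    (hc : ∀ e ∈ G.edgeSet, ∀ e' ∈ G.edgeSet, c e = c e' →
      e = e' ∨ ∃ j : ZMod 6, e = s(v j, v (j + 1)) ∧ e' = s(v (j + 3), v (j + 3 + 1))) :
    IsRainbowConnected G c := by
  classical
  set H := G.deleteEdges (cycleEdges v) with hH
  have hle : H ≤ G := SimpleGraph.deleteEdges_le _
  have hmem : ∀ {a b : V} (p : H.Walk a b), ∀ e ∈ p.edges, e ∈ G.edgeSet ∧ e ∉ cycleEdges v := by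
    intro a b p e he
    have := p.edges_subset_edgeSet he
    rwa [hH, SimpleGraph.edgeSet_deleteEdges] at this
  have hcH : ∀ e ∈ G.edgeSet, e ∉ cycleEdges v → ∀ e' ∈ G.edgeSet, c e = c e' → e = e' := by
    intro e he heC e' he' h
    rcases hc e he e' he' h with h | ⟨j, hj, -⟩
    · exact h
    · exact absurd ⟨j, hj⟩ heC
  have hnodup : ∀ {a b : V} (p : H.Walk a b), p.IsPath → (p.edges.map c).Nodup := by
    intro a b p hp
    refine hp.isTrail.edges_nodup.map_on fun e he e' he' h => ?_
    exact hcH e (hmem p e he).1 (hmem p e he).2 e' (hmem p e' he').1 h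
  apply isRainbowConnected_of_walk
  intro u w
  obtain ⟨j, hj⟩ := exists_reachable_deleteEdges_cycleEdges (v := v) hconn u
  obtain ⟨k, hk⟩ := exists_reachable_deleteEdges_cycleEdges (v := v) hconn w
  by_cases hjk : j = k
  · subst hjk
    obtain ⟨p, hp, -⟩ := (hj.symm.trans hk).exists_path_of_dist
    refine ⟨p.mapLe hle, ?_⟩
    rw [SimpleGraph.Walk.edges_mapLe_eq_edges]
    exact hnodup p hp
  · obtain ⟨p, hp, -⟩ := hj.symm.exists_path_of_dist
    obtain ⟨r, hr, -⟩ := hk.exists_path_of_dist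
    obtain ⟨q, hqC, hq⟩ := exists_rainbow_walk_hexagon hinj hadj hc j k
    refine ⟨((p.mapLe hle).append q).append (r.mapLe hle), ?_⟩
    simp only [SimpleGraph.Walk.edges_append, SimpleGraph.Walk.edges_mapLe_eq_edges,
      List.map_append]
    have hqG : ∀ e ∈ q.edges, e ∈ G.edgeSet := fun e he => q.edges_subset_edgeSet he
    refine List.Nodup.append (List.Nodup.append (hnodup p hp) hq ?_) (hnodup r hr) ?_
    · intro x hx hx'
      obtain ⟨e, he, rfl⟩ := List.mem_map.1 hx
      obtain ⟨e', he', h⟩ := List.mem_map.1 hx'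
      have := hcH e (hmem p e he).1 (hmem p e he).2 e' (hqG e' he') h.symm
      exact (hmem p e he).2 (this ▸ hqC e' he')
    · intro x hx hx'
      obtain ⟨e, he, rfl⟩ := List.mem_map.1 hx'
      rcases List.mem_append.1 hx with hx | hx
      · obtain ⟨e', he', h⟩ := List.mem_map.1 hx
        obtain rfl := hcH e (hmem r e he).1 (hmem r e he).2 e' (hmem p e' he').1 h.symm
        induction e with
        | _ a b =>
          have h1 : H.Reachable u a :=
            ⟨p.takeUntil a (p.fst_mem_support_of_mem_edges he')⟩
          have h2 : H.Reachable (v k) a :=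
            ⟨r.takeUntil a (r.fst_mem_support_of_mem_edges he)⟩
          exact hjk (eq_of_reachable_deleteEdges_hexagon hconn huni hinj hadj
            ((hj.trans h1).trans h2.symm))
      · obtain ⟨e', he', h⟩ := List.mem_map.1 hx
        have := hcH e (hmem r e he).1 (hmem r e he).2 e' (hqG e' he') h.symm
        exact (hmem r e he).2 (this ▸ hqC e' he')

/-- Walking from the component of `v i` to the component of `v (i + 3)` takes at least three
hexagon edges besides the two tree parts. -/
lemma dist_add_dist_add_three_le_length (hconn : G.Connected)
    (huni : G.edgeSet.ncard = Fintype.card V) (hinj : Function.Injective v)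
    (hadj : ∀ i, G.Adj (v i) (v (i + 1))) (i : ZMod 6) {x w : V}
    (hx : (G.deleteEdges (cycleEdges v)).Reachable (v i) x)
    (hw : (G.deleteEdges (cycleEdges v)).Reachable (v (i + 3)) w) (p : G.Walk x w) :
    (G.deleteEdges (cycleEdges v)).dist (v i) x +
      (G.deleteEdges (cycleEdges v)).dist (v (i + 3)) w + 3 ≤ p.length := by
  set H := G.deleteEdges (cycleEdges v) with hH
  choose κ hκ using exists_reachable_deleteEdges_cycleEdges (G := G) (v := v) hconn
  have hκ' : ∀ {j y}, H.Reachable (v j) y → κ y = j := fun {j y} h =>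
    eq_of_reachable_deleteEdges_hexagon hconn huni hinj hadj ((hκ y).trans h.symm)
  let h : ZMod 6 → ℤ := ![0, 1, 2, 3, 2, 1]
  have hh : ∀ j : ZMod 6, h (j + 1) - h j ≤ 1 ∧ h j - h (j + 1) ≤ 1 := by decide
  let f : V → ℤ := fun y =>
    h (κ y - i) + (if κ y = i then -1 else 1) * (H.dist (v (κ y)) y : ℤ)
  have hf0 : ∀ j, f (v j) = h (j - i) := by
    intro j
    have : κ (v j) = j := hκ' .rfl
    simp [f, this]
  have hf : ∀ a b, G.Adj a b → f b - f a ≤ 1 := by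
    intro a b hab
    by_cases he : s(a, b) ∈ cycleEdges v
    · obtain ⟨j, hj⟩ := he
      have h1 := hh (j - i)
      have h2 : j + 1 - i = j - i + 1 := by ring
      rcases Sym2.eq_iff.1 hj with ⟨rfl, rfl⟩ | ⟨rfl, rfl⟩
      · rw [hf0, hf0, h2]; exact h1.1
      · rw [hf0, hf0, h2]; exact h1.2
    · have hadjH : H.Adj a b := SimpleGraph.deleteEdges_adj.2 ⟨hab, he⟩
      have hκab : κ b = κ a := hκ' ((hκ a).trans hadjH.reachable)
      have hd := hadjH.diff_dist_adj (u := v (κ a))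
      simp only [f, hκab]
      split_ifs <;> omega
  have hfp := p.sub_le_length f hf
  have h3 : i + 3 ≠ i := (by decide : ∀ j : ZMod 6, j + 3 ≠ j) i
  have h3' : i + 3 - i = 3 := by ring
  have hfx : f x = -(H.dist (v i) x : ℤ) := by
    have : h 0 = 0 := rfl
    simp [f, hκ' hx, this]
  have hfw : f w = 3 + (H.dist (v (i + 3)) w : ℤ) := by
    have : h 3 = 3 := rfl
    simp only [f, hκ' hw, h3', this, if_neg h3, one_mul]
  rw [hfx, hfw] at hfp
  omega

end Hexagon

/-- Let `G` be a connected unicyclic graph with m edges whose unique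
cycle `v₁v₂v₃v₄v₅v₆v₁` has length 6. If for some index `i` (mod 6), `l(vᵢ) ≤ 1`,
`l(v_{i+3}) ≤ 1` and `l(v_{i+1}) = l(v_{i+2}) = l(v_{i+4}) = l(v_{i+5}) = 0`,
then rc(G) = m − 3. -/
theorem stmt_15 {V : Type*} [Fintype V] (G : SimpleGraph V)
    (hconn : G.Connected) (huni : G.edgeSet.ncard = Fintype.card V)
    (v : ZMod 6 → V) (hinj : Function.Injective v)
    (hadj : ∀ i : ZMod 6, G.Adj (v i) (v (i + 1)))
    (hl : ∃ i : ZMod 6, numLeaves G v i ≤ 1 ∧ numLeaves G v (i + 3) ≤ 1 ∧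
      numLeaves G v (i + 1) = 0 ∧ numLeaves G v (i + 2) = 0 ∧
      numLeaves G v (i + 4) = 0 ∧ numLeaves G v (i + 5) = 0) :
    rc G = G.edgeSet.ncard - 3 := by

  classical
  obtain ⟨i, h0, h3, h1, h2, h4, h5⟩ := hl
  have hac := isAcyclic_deleteEdges_hexagon hconn huni hinj hadj
  obtain ⟨x, hx, hxcard⟩ := hac.exists_ncard_reachable_le_dist (v i) h0
  obtain ⟨w, hw, hwcard⟩ := hac.exists_ncard_reachable_le_dist (v (i + 3)) h3
  have c1 := hac.ncard_reachable_le_one (v (i + 1)) h1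
  have c2 := hac.ncard_reachable_le_one (v (i + 2)) h2
  have c4 := hac.ncard_reachable_le_one (v (i + 4)) h4
  have c5 := hac.ncard_reachable_le_one (v (i + 5)) h5
  set H := G.deleteEdges (cycleEdges v) with hH
  set A : ZMod 6 → Set V := fun j => {y | H.Reachable (v j) y} with hA
  have hcover : (Set.univ : Set V) ⊆
      A i ∪ (A (i + 1) ∪ (A (i + 2) ∪ (A (i + 3) ∪ (A (i + 4) ∪ A (i + 5))))) := by
    intro y _
    obtain ⟨j, hj⟩ := exists_reachable_deleteEdges_cycleEdges (v := v) hconn y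
    have hdec : ∀ i j : ZMod 6,
        j = i ∨ j = i + 1 ∨ j = i + 2 ∨ j = i + 3 ∨ j = i + 4 ∨ j = i + 5 := by decide
    have hjA : y ∈ A j := hj
    rcases hdec i j with rfl | rfl | rfl | rfl | rfl | rfl <;> simp only [Set.mem_union, hjA] <;>
      tauto
  have hn : Fintype.card V ≤ H.dist (v i) x + H.dist (v (i + 3)) w + 6 := by
    have u0 := Set.ncard_le_ncard hcover
    rw [Set.ncard_univ, Nat.card_eq_fintype_card] at u0
    have u1 := Set.ncard_union_le (A i)
      (A (i + 1) ∪ (A (i + 2) ∪ (A (i + 3) ∪ (A (i + 4) ∪ A (i + 5)))))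
    have u2 := Set.ncard_union_le (A (i + 1)) (A (i + 2) ∪ (A (i + 3) ∪ (A (i + 4) ∪ A (i + 5))))
    have u3 := Set.ncard_union_le (A (i + 2)) (A (i + 3) ∪ (A (i + 4) ∪ A (i + 5)))
    have u4 := Set.ncard_union_le (A (i + 3)) (A (i + 4) ∪ A (i + 5))
    have u5 := Set.ncard_union_le (A (i + 4)) (A (i + 5))
    simp only [hA] at u0 u1 u2 u3 u4 u5
    omega
  obtain ⟨c, hc⟩ := exists_coloring_hexagon huni hinj hadj
  have hmem : G.edgeSet.ncard - 3 ∈ {k : ℕ | ∃ c : Sym2 V → Fin k, IsRainbowConnected G c} :=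
    ⟨c, isRainbowConnected_hexagon hconn huni hinj hadj hc⟩
  refine le_antisymm (Nat.sInf_le hmem) (le_csInf ⟨_, hmem⟩ ?_)
  rintro k ⟨c', hc'⟩
  obtain ⟨p, hp⟩ := hc'.exists_walk_length_le x w
  have := dist_add_dist_add_three_le_length hconn huni hinj hadj i hx hw p
  rw [← hH] at this
  omega
end

section
/- Let G be a graph with m edges obtained from K₄ − e (the complete graph on 4 vertices with one edge removed) by attaching a (possibly trivial) path at each of the two vertices of degree 2 of K₄ − e. Then rc(G) = m − 3. -/
/-- The graph obtained from `K₄ − e` (on the vertices `inl 0, inl 1, inl 2, inl 3`,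
where the missing edge is `{inl 2, inl 3}`, so `inl 2` and `inl 3` are its two
vertices of degree 2) by attaching a path with `p` further vertices at `inl 2`
and a path with `q` further vertices at `inl 3` (the paths are trivial when
`p = 0`, resp. `q = 0`). -/
def K4mePaths (p q : ℕ) : SimpleGraph (Fin 4 ⊕ (Fin p ⊕ Fin q)) :=
  SimpleGraph.fromRel (fun a b =>
    (∃ i j : Fin 4, a = Sum.inl i ∧ b = Sum.inl j ∧ i < j ∧ ¬(i = 2 ∧ j = 3))
    ∨ (a = Sum.inl 2 ∧ ∃ k : Fin p, b = Sum.inr (Sum.inl k) ∧ (k : ℕ) = 0)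
    ∨ (a = Sum.inl 3 ∧ ∃ k : Fin q, b = Sum.inr (Sum.inr k) ∧ (k : ℕ) = 0)
    ∨ (∃ k l : Fin p, a = Sum.inr (Sum.inl k) ∧ b = Sum.inr (Sum.inl l) ∧ (l : ℕ) = (k : ℕ) + 1)
    ∨ (∃ k l : Fin q, a = Sum.inr (Sum.inr k) ∧ b = Sum.inr (Sum.inr l) ∧ (l : ℕ) = (k : ℕ) + 1))

/-- If the vertices of `G` have levels such that consecutive levels are completely joined, a vertex
can be joined to any vertex at a higher level by a walk climbing one level at each step. -/
theorem SimpleGraph.exists_walk_map_level_eq_range' {V : Type*} {G : SimpleGraph V} {N : ℕ}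
    {f : V → ℕ} (hsurj : ∀ i ≤ N, ∃ v, f v = i) (hadj : ∀ a b, f b = f a + 1 → G.Adj a b) (n : ℕ)
    (u w : V) (hw : f w ≤ N) (h : f w = f u + (n + 1)) :
    ∃ p : G.Walk u w, p.support.map f = List.range' (f u) (n + 2) ∧
      p.edges.map (Sym2.lift ⟨fun a b => min (f a) (f b), fun _ _ => min_comm _ _⟩) =
        List.range' (f u) (n + 1) := by
  induction n generalizing u with
  | zero =>
    refine ⟨(hadj u w h).toWalk, ?_, ?_⟩ <;> simp [List.range'_succ, h]
  | succ n ih =>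
    obtain ⟨v, hv⟩ := hsurj (f u + 1) (by omega)
    obtain ⟨p, hp, hc⟩ := ih v (by omega)
    refine ⟨.cons (hadj u v hv) p, ?_, ?_⟩
    · rw [SimpleGraph.Walk.support_cons, List.map_cons, hp, hv, List.range'_succ (n := n + 2)]
    · rw [SimpleGraph.Walk.edges_cons, List.map_cons, hc, hv, List.range'_succ (n := n + 1)]
      simp [hv]

theorem SimpleGraph.Walk.level_le_add_length {V : Type*} {G : SimpleGraph V} {f : V → ℕ}
    (hadj : ∀ a b, G.Adj a b → f b ≤ f a + 1) {u w : V} (p : G.Walk u w) :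
    f w ≤ f u + p.length := by
  induction p with
  | nil => simp
  | cons h p ih =>
    have := hadj _ _ h
    rw [SimpleGraph.Walk.length_cons]
    omega

/-- A graph whose vertices have levels `0, …, M + 1`, all of them occupied, with distinct vertices
adjacent exactly when their levels differ by at most one, has rainbow connection number `M + 1`. -/
theorem rc_eq_of_level {V : Type*} {G : SimpleGraph V} {M : ℕ} {f : V → ℕ}
    (hf : ∀ v, f v ≤ M + 1) (hsurj : ∀ i ≤ M + 1, ∃ v, f v = i)
    (hadj : ∀ a b, G.Adj a b ↔ a ≠ b ∧ f a ≤ f b + 1 ∧ f b ≤ f a + 1) :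
    rc G = M + 1 := by
  have hup : ∀ a b, f b = f a + 1 → G.Adj a b := fun a b h =>
    (hadj a b).2 ⟨by rintro rfl; omega, by omega, by omega⟩
  let c₀ : Sym2 V → ℕ := Sym2.lift ⟨fun a b => min (f a) (f b), fun _ _ => min_comm _ _⟩
  let c : Sym2 V → Fin (M + 1) := fun e => Fin.ofNat (M + 1) (c₀ e)
  have hlt : ∀ u w, f u < f w → ∃ p : G.Walk u w, p.IsPath ∧ (p.edges.map c).Nodup := by
    intro u w h
    obtain ⟨n, hn⟩ := Nat.exists_eq_add_of_lt h
    obtain ⟨p, hs, he⟩ := SimpleGraph.exists_walk_map_level_eq_range' hsurj hup n u w (hf w) hn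
    refine ⟨p, SimpleGraph.Walk.IsPath.mk' (List.Nodup.of_map f ?_), ?_⟩
    · rw [hs]; exact List.nodup_range'
    · have : p.edges.map c = (List.range' (f u) (n + 1)).map (Fin.ofNat (M + 1)) := by
        rw [← he, List.map_map]; rfl
      rw [this]
      refine List.Nodup.map_on ?_ List.nodup_range'
      intro x hx y hy hxy
      rw [List.mem_range'_1] at hx hy
      have := hf w
      have hval := congrArg Fin.val hxy
      rwa [Fin.val_ofNat, Fin.val_ofNat, Nat.mod_eq_of_lt (by omega),
        Nat.mod_eq_of_lt (by omega)] at hval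
  have hc : IsRainbowConnected G c := by
    intro u w
    rcases lt_trichotomy (f u) (f w) with h | h | h
    · exact hlt u w h
    · by_cases huw : u = w
      · subst huw
        exact ⟨.nil, by simp⟩
      · have had := (hadj u w).2 ⟨huw, by omega, by omega⟩
        exact ⟨had.toWalk, by simp [huw]⟩
    · obtain ⟨p, hp, hc⟩ := hlt w u h
      exact ⟨p.reverse, hp.reverse, by simpa using hc⟩
  refine le_antisymm (Nat.sInf_le ⟨c, hc⟩) (le_csInf ⟨M + 1, c, hc⟩ ?_)
  rintro k ⟨d, hd⟩
  obtain ⟨u, hu⟩ := hsurj 0 (by omega)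
  obtain ⟨w, hw⟩ := hsurj (M + 1) le_rfl
  obtain ⟨p, -, hp⟩ := hd u w
  have h1 := p.level_le_add_length fun a b h => ((hadj a b).1 h).2.2
  have h2 := hp.length_le_card
  rw [List.length_map, SimpleGraph.Walk.length_edges, Fintype.card_fin] at h2
  omega

/-- The distance from the free end of the path attached at `inl 2`. -/
def K4mePaths.level (p q : ℕ) : Fin 4 ⊕ (Fin p ⊕ Fin q) → ℕ
  | .inl i => ![p + 1, p + 1, p, p + 2] i
  | .inr (.inl k) => p - 1 - k
  | .inr (.inr k) => p + 3 + k

theorem K4mePaths.level_le (p q : ℕ) (v) : level p q v ≤ p + q + 2 := by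
  rcases v with i | k | k
  · fin_cases i <;> simp [level] <;> omega
  · simp only [level]; omega
  · simp only [level]; omega

theorem K4mePaths.exists_level_eq (p q i : ℕ) (hi : i ≤ p + q + 2) : ∃ v, level p q v = i := by
  by_cases h : i < p
  · exact ⟨.inr (.inl ⟨p - 1 - i, by omega⟩), by simp only [level]; omega⟩
  by_cases h' : p + 3 ≤ i
  · exact ⟨.inr (.inr ⟨i - (p + 3), by omega⟩), by simp only [level]; omega⟩
  obtain rfl | rfl | rfl : i = p ∨ i = p + 1 ∨ i = p + 2 := by omega
  · exact ⟨.inl 2, rfl⟩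
  · exact ⟨.inl 0, rfl⟩
  · exact ⟨.inl 3, rfl⟩

theorem K4mePaths.adj_iff (p q : ℕ) (a b) : (K4mePaths p q).Adj a b ↔
    a ≠ b ∧ level p q a ≤ level p q b + 1 ∧ level p q b ≤ level p q a + 1 := by
  rw [K4mePaths, SimpleGraph.fromRel_adj]
  refine and_congr_right fun hab => ?_
  rcases a with i | k | k <;> rcases b with j | l | l
  · fin_cases i <;> fin_cases j <;> simp [level, add_assoc] at hab ⊢
  · fin_cases i <;> simp [level] <;> omega
  · fin_cases i <;> simp [level] <;> omega
  · fin_cases j <;> simp [level] <;> omega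
  · have hkl : (k : ℕ) ≠ l := fun h => hab (by rw [Fin.ext h])
    simp [level]; omega
  · simp [level]; omega
  · fin_cases j <;> simp [level] <;> omega
  · simp [level]; omega
  · have hkl : (k : ℕ) ≠ l := fun h => hab (by rw [Fin.ext h])
    simp [level]; omega

/-- The edges of `K4mePaths p q`: the five edges of `K₄ − e`, and the edge from each further vertex
to its predecessor on its path. -/
def K4mePaths.edge (p q : ℕ) : Fin 5 ⊕ (Fin p ⊕ Fin q) → Sym2 (Fin 4 ⊕ (Fin p ⊕ Fin q))
  | .inl i => ![s(.inl 0, .inl 1), s(.inl 0, .inl 2), s(.inl 0, .inl 3), s(.inl 1, .inl 2),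
      s(.inl 1, .inl 3)] i
  | .inr (.inl k) => s(.inr (.inl k),
      if (k : ℕ) = 0 then .inl 2 else .inr (.inl ⟨k - 1, by omega⟩))
  | .inr (.inr k) => s(.inr (.inr k),
      if (k : ℕ) = 0 then .inl 3 else .inr (.inr ⟨k - 1, by omega⟩))

theorem K4mePaths.edge_injective (p q : ℕ) : Function.Injective (edge p q) := by
  rintro (i | k | k) (j | l | l) h
  · fin_cases i <;> fin_cases j <;> simp [edge] at h ⊢
  · fin_cases i <;> simp [edge] at h
  · fin_cases i <;> simp [edge] at h
  · fin_cases j <;> simp [edge] at h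
  · simp only [edge] at h
    split_ifs at h <;> simp [Fin.ext_iff] at h ⊢ <;> omega
  · simp only [edge] at h
    split_ifs at h <;> simp at h
  · fin_cases j <;> simp [edge] at h
  · simp only [edge] at h
    split_ifs at h <;> simp at h
  · simp only [edge] at h
    split_ifs at h <;> simp [Fin.ext_iff] at h ⊢ <;> omega

theorem K4mePaths.range_edge (p q : ℕ) : Set.range (edge p q) = (K4mePaths p q).edgeSet := by
  apply Set.Subset.antisymm
  · rintro _ ⟨i | k | k, rfl⟩
    · fin_cases i <;> simp [edge, adj_iff, level, add_assoc]
    · simp only [edge]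
      split_ifs <;> simp [adj_iff, level, Fin.ext_iff] <;> omega
    · simp only [edge]
      split_ifs <;> simp [adj_iff, level, Fin.ext_iff] <;> omega
  · intro e
    induction e with | _ a b
    rw [SimpleGraph.mem_edgeSet, K4mePaths, SimpleGraph.fromRel_adj]
    rintro ⟨-, h | h⟩
    on_goal 2 => rw [Sym2.eq_swap]
    all_goals
      obtain ⟨i, j, rfl, rfl, hij, hne⟩ | ⟨rfl, k, rfl, hk⟩ | ⟨rfl, k, rfl, hk⟩ |
        ⟨k, l, rfl, rfl, hl⟩ | ⟨k, l, rfl, rfl, hl⟩ := h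
      · fin_cases i <;> fin_cases j <;> simp at hij hne
        · exact ⟨.inl 0, rfl⟩
        · exact ⟨.inl 1, rfl⟩
        · exact ⟨.inl 2, rfl⟩
        · exact ⟨.inl 3, rfl⟩
        · exact ⟨.inl 4, rfl⟩
      · exact ⟨.inr (.inl k), by simp [edge, hk]⟩
      · exact ⟨.inr (.inr k), by simp [edge, hk]⟩
      · exact ⟨.inr (.inl l), by simp [edge, hl]⟩
      · exact ⟨.inr (.inr l), by simp [edge, hl]⟩

theorem K4mePaths.ncard_edgeSet (p q : ℕ) : (K4mePaths p q).edgeSet.ncard = p + q + 5 := by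
  rw [← range_edge, ← Nat.card_coe_set_eq, Nat.card_range_of_injective (edge_injective p q)]
  simp
  omega

/-- If `G` is obtained from `K₄ − e` by attaching a (possibly
trivial) path at each of the two vertices of degree 2 of `K₄ − e`, then
rc(G) = m − 3, where m is the number of edges of `G`. -/
theorem stmt_17 {V : Type*} [Fintype V] (G : SimpleGraph V)
    (h : ∃ p q : ℕ, Nonempty (G ≃g K4mePaths p q)) :
    rc G = G.edgeSet.ncard - 3 := by
  obtain ⟨p, q, ⟨φ⟩⟩ := h
  have hcard : G.edgeSet.ncard = p + q + 5 := by
    rw [← K4mePaths.ncard_edgeSet, ← Nat.card_coe_set_eq, ← Nat.card_coe_set_eq]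
    exact Nat.card_congr φ.mapEdgeSet
  rw [hcard]
  refine rc_eq_of_level (M := p + q + 1) (f := fun v => K4mePaths.level p q (φ v))
    (fun v => K4mePaths.level_le p q _) (fun i hi => ?_) (fun a b => ?_)
  · obtain ⟨v, hv⟩ := K4mePaths.exists_level_eq p q i hi
    exact ⟨φ.symm v, by simpa using hv⟩
  · rw [← φ.map_adj_iff, K4mePaths.adj_iff, φ.injective.ne_iff]
end
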